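/- For the trivial system (ℂ, ℕ², id), the intersection of the two ideals I_δ and I_γ in the partial-isometric crossed product ℂ ×_id^piso ℕ² ≅ T(ℤ²) ≅ T(ℤ) ⊗ T(ℤ) is isomorphic to K(ℓ²(ℕ)) ⊗ K(ℓ²(ℕ)) ≅ K(ℓ²(ℕ²)), and the quotient (I_δ + I_γ)/(I_δ ∩ I_γ) is isomorphic to [K(ℓ²(ℕ)) ⊗ C(𝕋)] ⊕ [K(ℓ²(ℕ)) ⊗ C(𝕋)]. -/

import Mathlib

/- Concrete model: `T(ℤ) ⊗ T(ℤ)` is realised on `ℓ²(ℕ × ℕ)` as the closed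
`*`-algebra generated by the two coordinate shifts `S₁, S₂`, `K(ℓ²(ℕ²))` as the
closed span of the rank-one basis operators, and `K(ℓ²(ℕ)) ⊗ C(𝕋)` as the closed
span inside `C(𝕋, B(ℓ²(ℕ)))` of the elementary tensors `z ↦ f(z) • (e_p ⊗ ē_q)`. -/

noncomputable abbrev H2 : Type := lp (fun _ : ℕ × ℕ => ℂ) 2

noncomputable abbrev H1 : Type := lp (fun _ : ℕ => ℂ) 2

noncomputable def rankOne2 (p q : ℕ × ℕ) : H2 →L[ℂ] H2 :=
  (innerSL ℂ (lp.single 2 q (1 : ℂ))).smulRight (lp.single 2 p (1 : ℂ))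

noncomputable def rankOne1 (p q : ℕ) : H1 →L[ℂ] H1 :=
  (innerSL ℂ (lp.single 2 q (1 : ℂ))).smulRight (lp.single 2 p (1 : ℂ))

/-- The Toeplitz algebra `T(ℤ²) = T(ℤ) ⊗ T(ℤ)`, generated by the shifts. -/
noncomputable def T2set (S₁ S₂ : H2 →L[ℂ] H2) : Set (H2 →L[ℂ] H2) :=
  closure ((StarAlgebra.adjoin ℂ {S₁, S₂} :
    StarSubalgebra ℂ (H2 →L[ℂ] H2)) : Set (H2 →L[ℂ] H2))

/-- The closed ideal of `T(ℤ²)` generated by `(1 − S₁S₁*) = (1 − SS*) ⊗ 1`. -/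
noncomputable def Idel (S₁ S₂ : H2 →L[ℂ] H2) : Set (H2 →L[ℂ] H2) :=
  closure ((Submodule.span ℂ {w : H2 →L[ℂ] H2 | ∃ x ∈ T2set S₁ S₂, ∃ y ∈ T2set S₁ S₂,
    w = x * (1 - S₁ * star S₁) * y} : Submodule ℂ (H2 →L[ℂ] H2)) : Set (H2 →L[ℂ] H2))

/-- The closed ideal of `T(ℤ²)` generated by `(1 − S₂S₂*) = 1 ⊗ (1 − SS*)`. -/
noncomputable def Igam (S₁ S₂ : H2 →L[ℂ] H2) : Set (H2 →L[ℂ] H2) :=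
  closure ((Submodule.span ℂ {w : H2 →L[ℂ] H2 | ∃ x ∈ T2set S₁ S₂, ∃ y ∈ T2set S₁ S₂,
    w = x * (1 - S₂ * star S₂) * y} : Submodule ℂ (H2 →L[ℂ] H2)) : Set (H2 →L[ℂ] H2))

/-- `K(ℓ²(ℕ²))`. -/
noncomputable def Compacts2 : Set (H2 →L[ℂ] H2) :=
  closure ((Submodule.span ℂ {T : H2 →L[ℂ] H2 | ∃ p q : ℕ × ℕ, T = rankOne2 p q} :
    Submodule ℂ (H2 →L[ℂ] H2)) : Set (H2 →L[ℂ] H2))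

/-- `K(ℓ²(ℕ)) ⊗ C(𝕋)`, realised inside `C(𝕋, B(ℓ²(ℕ)))`. -/
noncomputable def KC : Set C(Circle, H1 →L[ℂ] H1) :=
  closure ((Submodule.span ℂ {F : C(Circle, H1 →L[ℂ] H1) |
    ∃ (f : C(Circle, ℂ)) (p q : ℕ), ∀ z, F z = f z • rankOne1 p q} :
    Submodule ℂ C(Circle, H1 →L[ℂ] H1)) : Set C(Circle, H1 →L[ℂ] H1))

namespace Stmt16
open scoped ComplexConjugate ENNReal InnerProductSpace

section basics

variable {ι : Type*} [DecidableEq ι] {E : Type*} [NormedAddCommGroup E] [InnerProductSpace ℂ E]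

/-- Basis vector of `ℓ²(ι)`. -/
noncomputable def bv (i : ι) : lp (fun _ : ι => ℂ) 2 := lp.single 2 i (1 : ℂ)

lemma inner_bv (i j : ι) : inner ℂ (bv i) (bv j) = if i = j then (1 : ℂ) else 0 := by
  unfold bv
  rw [lp.inner_single_left, lp.coeFn_single]
  by_cases h : i = j
  · subst h; simp
  · simp [h]

lemma orthonormal_bv : Orthonormal ℂ (bv : ι → lp (fun _ : ι => ℂ) 2) := by
  rw [orthonormal_iff_ite]; exact inner_bv

lemma ext_bv {F : Type*} [NormedAddCommGroup F] [NormedSpace ℂ F]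
    {x y : lp (fun _ : ι => ℂ) 2 →L[ℂ] F} (h : ∀ i, x (bv i) = y (bv i)) : x = y := by
  refine lp.ext_continuousLinearMap (ENNReal.ofNat_ne_top) fun i => ?_
  ext
  exact h i

lemma ext_inner_bv {v w : lp (fun _ : ι => ℂ) 2}
    (h : ∀ i, inner ℂ (bv i) v = inner ℂ (bv i) w) : v = w := by
  ext i
  have := h i
  unfold bv at this
  rw [lp.inner_single_left, lp.inner_single_left] at this
  simpa using this

/-- The isometry out of `ℓ²` determined by an orthonormal family. -/
noncomputable def iso [CompleteSpace E] (v : ι → E) (hv : Orthonormal ℂ v) :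
    lp (fun _ : ι => ℂ) 2 →ₗᵢ[ℂ] E := hv.orthogonalFamily.linearIsometry

lemma iso_bv [CompleteSpace E] (v : ι → E) (hv : Orthonormal ℂ v) (i : ι) :
    iso v hv (bv i) = v i := by
  unfold iso bv
  rw [OrthogonalFamily.linearIsometry_apply_single]
  simp

/-- adjoint of an injective relabelling of the basis -/
lemma star_bv (C : lp (fun _ : ι => ℂ) 2 →L[ℂ] lp (fun _ : ι => ℂ) 2) (τ : ι → ι)
    (hτ : Function.Injective τ) (hC : ∀ i, C (bv i) = bv (τ i)) (j : ι) :
    (∀ i, τ i = j → star C (bv j) = bv i) ∧ ((∀ i, τ i ≠ j) → star C (bv j) = 0) := by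
  constructor
  · rintro i rfl
    apply ext_inner_bv
    intro k
    rw [ContinuousLinearMap.star_eq_adjoint, ContinuousLinearMap.adjoint_inner_right, hC,
      inner_bv, inner_bv]
    simp [hτ.eq_iff]
  · intro h
    apply ext_inner_bv
    intro k
    rw [ContinuousLinearMap.star_eq_adjoint, ContinuousLinearMap.adjoint_inner_right, hC,
      inner_bv]
    simp [h k]

end basics

lemma rankOne1_bv (p q m : ℕ) : rankOne1 p q (bv m) = if q = m then bv p else 0 := by
  have := inner_bv q m
  unfold rankOne1 
  unfold bv at *
  simp only [ContinuousLinearMap.smulRight_apply, innerSL_apply_apply, this]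
  split_ifs <;> simp

lemma rankOne2_bv (p q m : ℕ × ℕ) : rankOne2 p q (bv m) = if q = m then bv p else 0 := by
  have := inner_bv q m
  unfold rankOne2
  unfold bv at *
  simp only [ContinuousLinearMap.smulRight_apply, innerSL_apply_apply, this]
  split_ifs <;> simp

/-! ### The Toeplitz compression -/

open MeasureTheory AddCircle

/-- `L²(𝕋, ℓ²(ℕ))`. -/
noncomputable abbrev LL : Type :=
  Lp H1 2 (haarAddCircle : Measure UnitAddCircle)

/-- `z ↦ z^k e_m` as a continuous function. -/
noncomputable def fc (m : ℕ) (k : ℤ) : C(UnitAddCircle, H1) :=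
  ⟨fun t => (fourier k t : ℂ) • (bv m : H1), by fun_prop⟩

noncomputable def fL (m : ℕ) (k : ℤ) : LL :=
  ContinuousMap.toLp (E := H1) 2 (haarAddCircle : Measure UnitAddCircle) ℂ (fc m k)

lemma integral_fourier (k : ℤ) :
    ∫ t : UnitAddCircle, (fourier k t : ℂ) ∂haarAddCircle = if k = 0 then 1 else 0 := by
  have h := (orthonormal_iff_ite.mp (orthonormal_fourier (T := (1 : ℝ)))) 0 k
  rw [ContinuousMap.inner_toLp] at h
  simp only [eq_comm (a := k)]
  rw [← h]
  congr 1
  ext t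
  simp

lemma inner_fL (m m' : ℕ) (k k' : ℤ) :
    inner ℂ (fL m k) (fL m' k') = if m = m' ∧ k = k' then (1 : ℂ) else 0 := by
  rw [MeasureTheory.L2.inner_def]
  have h1 := ContinuousMap.coeFn_toLp (E := H1) (p := 2)
    (haarAddCircle : Measure UnitAddCircle) (𝕜 := ℂ) (fc m k)
  have h2 := ContinuousMap.coeFn_toLp (E := H1) (p := 2)
    (haarAddCircle : Measure UnitAddCircle) (𝕜 := ℂ) (fc m' k')
  have : ∫ t, inner ℂ (fL m k t) (fL m' k' t) ∂(haarAddCircle : Measure UnitAddCircle)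
      = ∫ t, (fourier (k' - k) t : ℂ) * (if m = m' then 1 else 0)
        ∂(haarAddCircle : Measure UnitAddCircle) := by
    apply integral_congr_ae
    filter_upwards [h1, h2] with t e1 e2
    unfold fL
    rw [e1, e2]
    simp only [fc, ContinuousMap.coe_mk, inner_smul_left, inner_smul_right, inner_bv]
    rw [sub_eq_add_neg, fourier_add, fourier_neg]
    ring
  rw [this, integral_mul_const, integral_fourier]
  by_cases h : m = m' <;> by_cases h' : k = k' <;> simp [h, h', sub_eq_zero, eq_comm]

end Stmt16

namespace Stmt16
open scoped ComplexConjugate ENNReal InnerProductSpace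
open MeasureTheory AddCircle

/-- Pull back along the additive model of `𝕋`. -/
noncomputable def pull (E : Type*) [NormedAddCommGroup E] [NormedSpace ℂ E] :
    C(Circle, E) →L[ℂ] C(UnitAddCircle, E) where
  toFun F := F.comp (⟨fun t => t.toCircle, by fun_prop⟩ : C(UnitAddCircle, Circle))
  map_add' _ _ := rfl
  map_smul' _ _ := rfl
  cont := ContinuousMap.continuous_precomp _

/-- Multiplication operators. -/
noncomputable def mulF : C(Circle, H1 →L[ℂ] H1) →L[ℂ] (LL →L[ℂ] LL) :=
  ((ContinuousLinearMap.id ℂ (H1 →L[ℂ] H1)).holderL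
      (haarAddCircle : Measure UnitAddCircle) ⊤ 2 2).comp
    ((ContinuousMap.toLp (E := H1 →L[ℂ] H1) ⊤ (haarAddCircle : Measure UnitAddCircle) ℂ).comp
      (pull (H1 →L[ℂ] H1)))

/-- `f ↦ f ⊗ E_ij`. -/
noncomputable def em (i j : ℕ) : C(Circle, ℂ) →L[ℂ] C(Circle, H1 →L[ℂ] H1) :=
  ContinuousLinearMap.compLeftContinuous ℂ Circle
    ((ContinuousLinearMap.id ℂ ℂ).smulRight (rankOne1 i j))

lemma em_apply (i j : ℕ) (f : C(Circle, ℂ)) (z : Circle) : em i j f z = f z • rankOne1 i j := rfl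

/-- `z ↦ z^n`. -/
noncomputable def zf (n : ℤ) : C(Circle, ℂ) := ⟨fun z => ((z ^ n : Circle) : ℂ),
  (by fun_prop : Continuous (fun z : Circle => (z : ℂ))).comp (continuous_zpow n)⟩

lemma zf_toCircle (n : ℤ) (t : UnitAddCircle) : zf n t.toCircle = fourier n t := by
  simp [zf, fourier_apply, AddCircle.toCircle_zsmul]

lemma mulF_fL (n : ℤ) (i j m : ℕ) (k : ℤ) :
    mulF (em i j (zf n)) (fL m k) = if j = m then fL i (k + n) else 0 := by
  have h1 := ContinuousMap.coeFn_toLp (E := H1) (p := 2)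
    (haarAddCircle : Measure UnitAddCircle) (𝕜 := ℂ) (fc m k)
  have h2 := ContinuousMap.coeFn_toLp (E := H1) (p := 2)
    (haarAddCircle : Measure UnitAddCircle) (𝕜 := ℂ) (fc i (k + n))
  have h3 := ContinuousMap.coeFn_toLp (E := H1 →L[ℂ] H1) (p := ⊤)
    (haarAddCircle : Measure UnitAddCircle) (𝕜 := ℂ) (pull _ (em i j (zf n)))
  have h4 := (ContinuousLinearMap.id ℂ (H1 →L[ℂ] H1)).coeFn_holder (r := 2)
    (ContinuousMap.toLp (E := H1 →L[ℂ] H1) ⊤ (haarAddCircle : Measure UnitAddCircle) ℂ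
      (pull _ (em i j (zf n)))) (fL m k)
  have h5 := Lp.coeFn_zero H1 2 (haarAddCircle : Measure UnitAddCircle)
  apply Lp.ext
  change ((ContinuousLinearMap.id ℂ (H1 →L[ℂ] H1)).holder 2 (ContinuousMap.toLp (E := H1 →L[ℂ] H1) ⊤
    (haarAddCircle : Measure UnitAddCircle) ℂ (pull _ (em i j (zf n)))) (fL m k)) =ᵐ[_] _
  filter_upwards [h1, h2, h3, h4, h5] with t e1 e2 e3 e4 e5
  rw [e4, e3]
  have e1' : (fL m k) t = fc m k t := e1
  rw [e1']
  have : (pull _ (em i j (zf n))) t = (fourier n t : ℂ) • rankOne1 i j := by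
    rw [← zf_toCircle]; rfl
  rw [this]
  simp only [fc, ContinuousMap.coe_mk, ContinuousLinearMap.id_apply, smul_apply,
    map_smul, rankOne1_bv]
  split_ifs with h
  · have e2' : (fL i (k + n)) t = fc i (k + n) t := e2
    rw [e2']
    simp only [fc, ContinuousMap.coe_mk, fourier_add, smul_smul, mul_comm]
  · rw [e5]; simp

lemma orthonormal_fL (σ : ℕ × ℕ ≃ ℕ × ℕ) :
    Orthonormal ℂ (fun p : ℕ × ℕ => fL (σ.symm p).1 (σ.symm p).2) := by
  rw [orthonormal_iff_ite]
  intro p q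
  rw [inner_fL]
  congr 1
  rw [Nat.cast_inj, ← Prod.ext_iff, σ.symm.injective.eq_iff]

noncomputable def U (σ : ℕ × ℕ ≃ ℕ × ℕ) : H2 →L[ℂ] LL :=
  (iso (fun p : ℕ × ℕ => fL (σ.symm p).1 (σ.symm p).2)
    (orthonormal_fL σ)).toContinuousLinearMap

lemma U_bv (σ : ℕ × ℕ ≃ ℕ × ℕ) (p : ℕ × ℕ) : U σ (bv p) = fL (σ.symm p).1 (σ.symm p).2 :=
  iso_bv _ (orthonormal_fL σ) _

lemma Uadj (σ : ℕ × ℕ ≃ ℕ × ℕ) (m : ℕ) (k : ℤ) :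
    ContinuousLinearMap.adjoint (U σ) (fL m k) = if 0 ≤ k then bv (σ (m, k.toNat)) else 0 := by
  apply ext_inner_bv
  intro p
  rw [ContinuousLinearMap.adjoint_inner_right, U_bv, inner_fL]
  split_ifs with h1 h2 h2
  · obtain ⟨h, h'⟩ := h1
    rw [inner_bv, if_pos]
    rw [← h, ← h']
    simp
  · exfalso; omega
  · rw [inner_bv, if_neg]
    rintro rfl
    apply h1
    simp [h2]
  · simp

/-- Toeplitz compression. -/
noncomputable def Tp (σ : ℕ × ℕ ≃ ℕ × ℕ) : C(Circle, H1 →L[ℂ] H1) →L[ℂ] (H2 →L[ℂ] H2) :=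
  ((ContinuousLinearMap.compL ℂ H2 LL H2 (ContinuousLinearMap.adjoint (U σ))).comp
    ((ContinuousLinearMap.compL ℂ H2 LL LL).flip (U σ))).comp mulF

lemma Tp_bv (σ : ℕ × ℕ ≃ ℕ × ℕ) (n : ℤ) (i j m k : ℕ) :
    Tp σ (em i j (zf n)) (bv (σ (m, k))) =
      if j = m ∧ 0 ≤ k + n then bv (σ (i, (k + n).toNat)) else 0 := by
  change ContinuousLinearMap.adjoint (U σ) (mulF (em i j (zf n)) (U σ (bv (σ (m, k))))) = _
  rw [U_bv, Equiv.symm_apply_apply, mulF_fL]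
  by_cases h : j = m
  · simp [h, Uadj]
  · simp [h]

lemma zf_dense (M : Submodule ℂ C(Circle, ℂ)) (hM : IsClosed (M : Set C(Circle, ℂ)))
    (h : ∀ n, zf n ∈ M) (f : C(Circle, ℂ)) : f ∈ M := by
  let e := AddCircle.homeomorphCircle (T := (1 : ℝ)) one_ne_zero
  let L : C(UnitAddCircle, ℂ) →L[ℂ] C(Circle, ℂ) :=
    { toFun := fun F => F.comp (e.symm : C(Circle, UnitAddCircle))
      map_add' := fun _ _ => rfl
      map_smul' := fun _ _ => rfl
      cont := ContinuousMap.continuous_precomp _ }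
  have h1 : (Submodule.span ℂ (Set.range (fourier (T := (1 : ℝ))))).topologicalClosure ≤
      M.comap L.toLinearMap := by
    apply Submodule.topologicalClosure_minimal
    · rw [Submodule.span_le]
      rintro _ ⟨n, rfl⟩
      have : L (fourier n) = zf n := by
        ext z
        change fourier n (e.symm z) = zf n z
        rw [← zf_toCircle, ← AddCircle.homeomorphCircle_apply one_ne_zero]
        congr 1
        exact e.apply_symm_apply z
      change L (fourier n) ∈ M
      rw [this]; exact h n
    · exact hM.preimage L.continuous
  rw [span_fourier_closure_eq_top] at h1
  have := h1 (Submodule.mem_top (x := f.comp (e : C(UnitAddCircle, Circle))))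
  have h2 : L (f.comp (e : C(UnitAddCircle, Circle))) = f := by
    ext z
    change f (e (e.symm z)) = f z
    rw [e.apply_symm_apply]
  rw [← h2]; exact this

lemma KC_sub (M : Submodule ℂ C(Circle, H1 →L[ℂ] H1))
    (hM : IsClosed (M : Set C(Circle, H1 →L[ℂ] H1)))
    (h : ∀ i j n, em i j (zf n) ∈ M) : KC ⊆ M := by
  apply closure_minimal _ hM
  apply SetLike.coe_subset_coe.mpr
  rw [Submodule.span_le]
  rintro F ⟨f, p, q, hF⟩
  have : F = em p q f := by ext1 z; rw [hF, em_apply]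
  rw [this]
  exact zf_dense (M.comap (em p q).toLinearMap) (hM.preimage (em p q).continuous) (h p q) f

lemma em_mem_KC (i j : ℕ) (f : C(Circle, ℂ)) : em i j f ∈ KC :=
  subset_closure (Submodule.subset_span ⟨f, i, j, fun _ => rfl⟩)

end Stmt16

namespace Stmt16
open scoped ComplexConjugate ENNReal InnerProductSpace Topology
open Filter

lemma injJ (σ : ℕ × ℕ ≃ ℕ × ℕ) (k : ℕ) : Function.Injective (fun m : ℕ => σ (m, k)) := by
  intro m m' h
  have := σ.injective h
  simpa using this

/-- `e_m ↦ e_m ⊗ e_k`. -/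
noncomputable def J (σ : ℕ × ℕ ≃ ℕ × ℕ) (k : ℕ) : H1 →ₗᵢ[ℂ] H2 :=
  iso (fun m => bv (σ (m, k))) (orthonormal_bv.comp _ (injJ σ k))

lemma J_bv (σ : ℕ × ℕ ≃ ℕ × ℕ) (k m : ℕ) : J σ k (bv m) = bv (σ (m, k)) :=
  iso_bv _ (orthonormal_bv.comp _ (injJ σ k)) _

noncomputable def JL (σ : ℕ × ℕ ≃ ℕ × ℕ) (k : ℕ) : H1 →L[ℂ] H2 := (J σ k).toContinuousLinearMap

lemma JL_bv (σ : ℕ × ℕ ≃ ℕ × ℕ) (k m : ℕ) : JL σ k (bv m) = bv (σ (m, k)) := J_bv σ k m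

lemma norm_JL (σ : ℕ × ℕ ≃ ℕ × ℕ) (k : ℕ) : ‖JL σ k‖ ≤ 1 :=
  (J σ k).norm_toContinuousLinearMap_le

lemma J_orth (σ : ℕ × ℕ ≃ ℕ × ℕ) : OrthogonalFamily ℂ (fun _ : ℕ => H1) (J σ) := by
  intro k l hkl v w
  have h : (ContinuousLinearMap.adjoint (JL σ k)).comp (JL σ l) = 0 := by
    apply ext_bv
    intro m
    apply ext_inner_bv
    intro m'
    rw [ContinuousLinearMap.comp_apply, ContinuousLinearMap.adjoint_inner_right, JL_bv, JL_bv,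
      inner_bv, if_neg]
    · simp
    · intro h
      have := σ.injective h
      simp at this
      exact hkl this.2
  have h2 := congrArg (fun T => inner ℂ v (T w)) h
  simp only [ContinuousLinearMap.comp_apply, ContinuousLinearMap.adjoint_inner_right] at h2
  exact h2.trans (by simp)

/-- The unilateral shift. -/
noncomputable def Sh : H1 →L[ℂ] H1 :=
  (iso (fun m : ℕ => (bv (m + 1) : H1))
    (orthonormal_bv.comp _ (add_left_injective 1))).toContinuousLinearMap

lemma Sh_bv (m : ℕ) : Sh (bv m) = bv (m + 1) :=
  iso_bv _ (orthonormal_bv.comp _ (add_left_injective 1)) _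

/-- Approximate eigen-isometries. -/
noncomputable def V (σ : ℕ × ℕ ≃ ℕ × ℕ) (n : ℕ) (z : Circle) : H1 →L[ℂ] H2 :=
  (((Real.sqrt (n + 1))⁻¹ : ℝ) : ℂ) •
    ∑ k ∈ Finset.range (n + 1), (conj (z : ℂ)) ^ k • JL σ k

lemma V_norm (σ : ℕ × ℕ ≃ ℕ × ℕ) (n : ℕ) (z : Circle) (ξ : H1) : ‖V σ n z ξ‖ = ‖ξ‖ := by
  have h := (J_orth σ).norm_sum (fun k => (conj (z : ℂ)) ^ k • ξ) (Finset.range (n + 1))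
  have h1 : ∑ k ∈ Finset.range (n + 1), J σ k ((conj (z : ℂ)) ^ k • ξ) =
      (∑ k ∈ Finset.range (n + 1), (conj (z : ℂ)) ^ k • JL σ k) ξ := by
    simp only [map_smul, sum_apply, smul_apply]
    rfl
  rw [h1] at h
  simp only [norm_smul, norm_pow, RCLike.norm_conj, Circle.norm_coe, one_pow, one_mul,
    Finset.sum_const, Finset.card_range, nsmul_eq_mul, Nat.cast_add, Nat.cast_one] at h
  have hn : (0 : ℝ) < n + 1 := by positivity
  have h2 : ‖V σ n z ξ‖ ^ 2 = ‖ξ‖ ^ 2 := by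
    unfold V
    rw [smul_apply, norm_smul, mul_pow, h]
    rw [Complex.norm_real, Real.norm_eq_abs, sq_abs, inv_pow, Real.sq_sqrt hn.le]
    field_simp
  exact (sq_eq_sq₀ (norm_nonneg _) (norm_nonneg _)).mp h2

lemma V_norm_le (σ : ℕ × ℕ ≃ ℕ × ℕ) (n : ℕ) (z : Circle) : ‖V σ n z‖ ≤ 1 :=
  ContinuousLinearMap.opNorm_le_bound _ zero_le_one fun ξ => by rw [V_norm, one_mul]

abbrev CB : Type := C(Circle, H1 →L[ℂ] H1)

set_option synthInstance.maxHeartbeats 400000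

lemma CB_star_add (F G : CB) : star (F + G) = star F + star G := by ext1 z; exact star_add _ _
lemma CB_star_mul (F G : CB) : star (F * G) = star G * star F := by ext1 z; exact star_mul _ _
lemma CB_star_smul (c : ℂ) (F : CB) : star (c • F) = star c • star F := by
  ext1 z
  change star (c • F z) = star c • star (F z)
  rw [star_smul]
lemma CB_star_star (F : CB) : star (star F) = F := star_star F
lemma CB_star_one : star (1 : CB) = 1 := star_one CB
lemma CB_neg_one (F : CB) : (-1 : ℂ) • F = -F := neg_one_smul ℂ F
lemma CB_pow_zero (F : CB) : F ^ 0 = 1 := pow_zero F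
lemma CB_pow_succ (F : CB) (n : ℕ) : F ^ (n + 1) = F ^ n * F := pow_succ F n
lemma CB_dist (F G : CB) : dist F G = ‖F - G‖ := dist_eq_norm F G

lemma continuous_starCB : Continuous (fun F : CB => star F) := by
  refine (Metric.continuous_iff (α := CB) (β := CB)).mpr ?_
  intro F ε hε
  refine ⟨ε, hε, fun G h => lt_of_le_of_lt ?_ h⟩
  rw [ContinuousMap.dist_le dist_nonneg]
  intro z
  refine le_trans ?_ (ContinuousMap.dist_apply_le_dist z)
  rw [ContinuousMap.star_apply, ContinuousMap.star_apply, dist_eq_norm, dist_eq_norm, ← star_sub,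
    norm_star]

/-- `x V_{n,z} ≈ V_{n,z} F(z)` uniformly in `z`. -/
def P (σ : ℕ × ℕ ≃ ℕ × ℕ) (x : H2 →L[ℂ] H2) (F : CB) : Prop :=
  ∀ ε > 0, ∃ N, ∀ n ≥ N, ∀ z, ‖x ∘L V σ n z - V σ n z ∘L F z‖ ≤ ε

variable {σ : ℕ × ℕ ≃ ℕ × ℕ} {x y : H2 →L[ℂ] H2} {F G : CB}

lemma P.add (hx : P σ x F) (hy : P σ y G) : P σ (x + y) (F + G) := by
  intro ε hε
  obtain ⟨N, hN⟩ := hx (ε / 2) (by positivity)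
  obtain ⟨M, hM⟩ := hy (ε / 2) (by positivity)
  refine ⟨max N M, fun n hn z => ?_⟩
  have e : (x + y) ∘L V σ n z - V σ n z ∘L (F + G) z =
    (x ∘L V σ n z - V σ n z ∘L F z) + (y ∘L V σ n z - V σ n z ∘L G z) := by
    ext1 ξ; simp; abel
  rw [e]
  have h1 := hN n (le_trans (le_max_left _ _) hn) z
  have h2 := hM n (le_trans (le_max_right _ _) hn) z
  exact (norm_add_le _ _).trans (by linarith)

lemma P.mul (hx : P σ x F) (hy : P σ y G) : P σ (x * y) (F * G) := by
  intro ε hε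
  obtain ⟨N, hN⟩ := hx (ε / (2 * (‖G‖ + 1))) (by positivity)
  obtain ⟨M, hM⟩ := hy (ε / (2 * (‖x‖ + 1))) (by positivity)
  refine ⟨max N M, fun n hn z => ?_⟩
  have e : (x * y) ∘L V σ n z - V σ n z ∘L (F * G) z =
    x ∘L (y ∘L V σ n z - V σ n z ∘L G z) + (x ∘L V σ n z - V σ n z ∘L F z) ∘L G z := by
    ext1 ξ; simp
  rw [e]
  have h1 := hN n (le_trans (le_max_left _ _) hn) z
  have h2 := hM n (le_trans (le_max_right _ _) hn) z
  have h3 : ‖x ∘L (y ∘L V σ n z - V σ n z ∘L G z)‖ ≤ ε / 2 := by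
    refine (ContinuousLinearMap.opNorm_comp_le _ _).trans ?_
    calc ‖x‖ * _ ≤ (‖x‖ + 1) * (ε / (2 * (‖x‖ + 1))) := by gcongr; linarith
      _ = ε / 2 := by field_simp
  have h4 : ‖(x ∘L V σ n z - V σ n z ∘L F z) ∘L G z‖ ≤ ε / 2 := by
    refine (ContinuousLinearMap.opNorm_comp_le _ _).trans ?_
    calc _ ≤ (ε / (2 * (‖G‖ + 1))) * (‖G‖ + 1) := by
          gcongr
          exact (G.norm_coe_le_norm z).trans (by linarith)
      _ = ε / 2 := by field_simp
  exact (norm_add_le _ _).trans (by linarith)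

lemma P_one : P σ 1 1 := by
  intro ε hε
  refine ⟨0, fun n _ z => ?_⟩
  have : (1 : H2 →L[ℂ] H2) ∘L V σ n z - V σ n z ∘L (1 : CB) z = 0 := by ext1 ξ; simp
  rw [this]; simpa using hε.le

lemma P.smul (c : ℂ) (hx : P σ x F) : P σ (c • x) (c • F) := by
  intro ε hε
  obtain ⟨N, hN⟩ := hx (ε / (‖c‖ + 1)) (by positivity)
  refine ⟨N, fun n hn z => ?_⟩
  have e : (c • x) ∘L V σ n z - V σ n z ∘L (c • F) z = c • (x ∘L V σ n z - V σ n z ∘L F z) := by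
    ext1 ξ; simp [smul_sub]
  rw [e, norm_smul]
  calc ‖c‖ * _ ≤ (‖c‖ + 1) * (ε / (‖c‖ + 1)) := by
        gcongr
        · linarith
        · exact hN n hn z
    _ = ε := by field_simp

lemma P.norm_le (hx : P σ x F) : ‖F‖ ≤ ‖x‖ := by
  apply le_of_forall_pos_le_add
  intro ε hε
  obtain ⟨N, hN⟩ := hx ε hε
  rw [ContinuousMap.norm_le _ (by positivity)]
  intro z
  apply ContinuousLinearMap.opNorm_le_bound _ (by positivity)
  intro ξ
  have h := hN N le_rfl z
  have h1 : ‖(x ∘L V σ N z - V σ N z ∘L F z) ξ‖ ≤ ε * ‖ξ‖ :=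
    (ContinuousLinearMap.le_opNorm _ _).trans (by gcongr)
  have h2 : ‖x (V σ N z ξ)‖ ≤ ‖x‖ * ‖ξ‖ := by
    rw [← V_norm σ N z ξ]; exact x.le_opNorm _
  rw [← V_norm σ N z (F z ξ)]
  have e : V σ N z (F z ξ) = x (V σ N z ξ) - (x ∘L V σ N z - V σ N z ∘L F z) ξ := by simp
  rw [e]
  refine (norm_sub_le _ _).trans ?_
  linarith

lemma P.lim {u : ℕ → H2 →L[ℂ] H2} {Fu : ℕ → CB} (h : ∀ k, P σ (u k) (Fu k))
    (hu : Tendsto u atTop (𝓝 x)) (hF : Tendsto Fu atTop (𝓝 F)) : P σ x F := by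
  intro ε hε
  have h1 := (Metric.tendsto_atTop.mp hu) (ε / 3) (by positivity)
  have h2 := ((Metric.tendsto_atTop (α := CB)).mp hF) (ε / 3) (by positivity)
  obtain ⟨K, hK⟩ := h1
  obtain ⟨L, hL⟩ := h2
  have h1 := hK (max K L) (le_max_left _ _)
  have h2 := hL (max K L) (le_max_right _ _)
  set k := max K L
  obtain ⟨N, hN⟩ := h k (ε / 3) (by positivity)
  refine ⟨N, fun n hn z => ?_⟩
  have e : x ∘L V σ n z - V σ n z ∘L F z = -((u k - x) ∘L V σ n z) +
     ((u k) ∘L V σ n z - V σ n z ∘L Fu k z) + V σ n z ∘L ((Fu k - F) z) := by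
    ext1 ξ; simp
  rw [e]
  have h3 := hN n hn z
  rw [dist_eq_norm] at h1
  rw [CB_dist] at h2
  have h4 : ‖(u k - x) ∘L V σ n z‖ ≤ ε / 3 := by
    refine (ContinuousLinearMap.opNorm_comp_le _ _).trans ?_
    calc _ ≤ (ε / 3) * 1 := by gcongr; exact V_norm_le σ n z
      _ = ε / 3 := mul_one _
  have h5 : ‖V σ n z ∘L ((Fu k - F) z)‖ ≤ ε / 3 := by
    refine (ContinuousLinearMap.opNorm_comp_le _ _).trans ?_
    calc _ ≤ 1 * (ε / 3) := by
          gcongr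
          · exact V_norm_le σ n z
          · exact ((Fu k - F).norm_coe_le_norm z).trans h2.le
      _ = ε / 3 := one_mul _
  refine (norm_add₃_le).trans ?_
  rw [norm_neg]
  linarith

/-- Two-sided version. -/
def Rel (σ : ℕ × ℕ ≃ ℕ × ℕ) (x : H2 →L[ℂ] H2) (F : CB) : Prop :=
  P σ x F ∧ P σ (star x) (star F)

lemma Rel.add (hx : Rel σ x F) (hy : Rel σ y G) : Rel σ (x + y) (F + G) :=
  ⟨hx.1.add hy.1, by rw [star_add, CB_star_add]; exact hx.2.add hy.2⟩

lemma Rel.mul (hx : Rel σ x F) (hy : Rel σ y G) : Rel σ (x * y) (F * G) :=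
  ⟨hx.1.mul hy.1, by rw [star_mul, CB_star_mul]; exact hy.2.mul hx.2⟩

lemma Rel.smul (c : ℂ) (hx : Rel σ x F) : Rel σ (c • x) (c • F) :=
  ⟨hx.1.smul c, by rw [star_smul, CB_star_smul]; exact hx.2.smul _⟩

lemma Rel.star (hx : Rel σ x F) : Rel σ (star x) (star F) :=
  ⟨hx.2, by rw [star_star, CB_star_star]; exact hx.1⟩

lemma Rel_one : Rel σ 1 1 := ⟨P_one, by rw [star_one, CB_star_one]; exact P_one⟩

lemma Rel.neg (hx : Rel σ x F) : Rel σ (-x) (-F) := by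
  have := hx.smul (-1)
  rwa [neg_one_smul, CB_neg_one] at this

lemma Rel.sub (hx : Rel σ x F) (hy : Rel σ y G) : Rel σ (x - y) (F - G) := by
  rw [sub_eq_add_neg, sub_eq_add_neg]; exact hx.add hy.neg

lemma Rel_zero : Rel σ 0 0 := by
  have := (Rel_one (σ := σ)).sub Rel_one
  simpa using this

lemma Rel.pow (hx : Rel σ x F) (n : ℕ) : Rel σ (x ^ n) (F ^ n) := by
  induction n with
  | zero => rw [pow_zero, CB_pow_zero]; exact Rel_one
  | succ n ih => rw [pow_succ, CB_pow_succ]; exact ih.mul hx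

lemma Rel.norm_le (hx : Rel σ x F) : ‖F‖ ≤ ‖x‖ := hx.1.norm_le

lemma Rel.unique (hx : Rel σ x F) (hy : Rel σ x G) : F = G := by
  have := (hx.sub hy).norm_le
  rw [sub_self, norm_zero] at this
  exact sub_eq_zero.mp (norm_le_zero_iff.mp this)

lemma Rel.lim {u : ℕ → H2 →L[ℂ] H2} {Fu : ℕ → CB} (h : ∀ k, Rel σ (u k) (Fu k))
    (hu : Tendsto u atTop (𝓝 x)) : ∃ F, Tendsto Fu atTop (𝓝 F) ∧ Rel σ x F := by
  have hc : CauchySeq Fu := by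
    have h1 := hu.cauchySeq
    rw [Metric.cauchySeq_iff] at h1
    refine (Metric.cauchySeq_iff (α := CB)).mpr ?_
    intro ε hε
    obtain ⟨N, hN⟩ := h1 ε hε
    refine ⟨N, fun m hm n hn => lt_of_le_of_lt ?_ (hN m hm n hn)⟩
    rw [CB_dist, dist_eq_norm]
    exact ((h m).sub (h n)).norm_le
  obtain ⟨F, hF⟩ := cauchySeq_tendsto_of_complete hc
  refine ⟨F, hF, P.lim (fun k => (h k).1) hu hF, P.lim (fun k => (h k).2) ?_ ?_⟩
  · exact (continuous_star.tendsto x).comp hu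
  · exact (continuous_starCB.tendsto F).comp hF

end Stmt16

namespace Stmt16
open scoped ComplexConjugate ENNReal InnerProductSpace Topology
open Filter

set_option synthInstance.maxHeartbeats 400000

/-- `A` shifts the second coordinate and `B` the first, after relabelling by `σ`. -/
structure Sys (σ : ℕ × ℕ ≃ ℕ × ℕ) (A B : H2 →L[ℂ] H2) : Prop where
  hA : ∀ m k, A (bv (σ (m, k))) = bv (σ (m, k + 1))
  hB : ∀ m k, B (bv (σ (m, k))) = bv (σ (m + 1, k))

variable {σ : ℕ × ℕ ≃ ℕ × ℕ} {A B : H2 →L[ℂ] H2}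

lemma ext_σ {F : Type*} [NormedAddCommGroup F] [NormedSpace ℂ F] (σ : ℕ × ℕ ≃ ℕ × ℕ)
    {x y : H2 →L[ℂ] F} (h : ∀ m k, x (bv (σ (m, k))) = y (bv (σ (m, k)))) : x = y := by
  apply ext_bv
  intro p
  have := h (σ.symm p).1 (σ.symm p).2
  simpa using this

lemma Sys.mon (h : Sys σ A B) (a i m k : ℕ) :
    (A ^ a * B ^ i) (bv (σ (m, k))) = bv (σ (m + i, k + a)) := by
  have h1 : ∀ i m, (B ^ i) (bv (σ (m, k))) = bv (σ (m + i, k)) := by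
    intro i
    induction i with
    | zero => intro m; simp
    | succ i ih =>
      intro m
      rw [pow_succ', ContinuousLinearMap.mul_apply, ih, h.hB, add_assoc]
  have h2 : ∀ a m k, (A ^ a) (bv (σ (m, k))) = bv (σ (m, k + a)) := by
    intro a
    induction a with
    | zero => intro m k; simp
    | succ i ih =>
      intro m k
      rw [pow_succ', ContinuousLinearMap.mul_apply, ih, h.hA, add_assoc]
  rw [ContinuousLinearMap.mul_apply, h1, h2]

lemma Sys.star_mon (h : Sys σ A B) (a i m k : ℕ) :
    star (A ^ a * B ^ i) (bv (σ (m, k))) =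
      if i ≤ m ∧ a ≤ k then bv (σ (m - i, k - a)) else 0 := by
  have hs := star_bv (A ^ a * B ^ i)
    (fun p => σ ((σ.symm p).1 + i, (σ.symm p).2 + a)) (by
      intro p q hpq
      have := σ.injective hpq
      simp only [Prod.mk.injEq, add_left_inj] at this
      apply σ.symm.injective
      exact Prod.ext this.1 this.2) (by
      intro p
      have := h.mon a i (σ.symm p).1 (σ.symm p).2
      simpa using this) (σ (m, k))
  split_ifs with hc
  · apply hs.1
    simp only [Equiv.symm_apply_apply]
    rw [Nat.sub_add_cancel hc.1, Nat.sub_add_cancel hc.2]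
  · apply hs.2
    intro p hp
    have := σ.injective hp
    simp only [Prod.mk.injEq] at this
    omega

lemma Sys.starA (h : Sys σ A B) (m k : ℕ) :
    star A (bv (σ (m, k))) = if 1 ≤ k then bv (σ (m, k - 1)) else 0 := by
  simpa using h.star_mon 1 0 m k

lemma Sys.starB (h : Sys σ A B) (m k : ℕ) :
    star B (bv (σ (m, k))) = if 1 ≤ m then bv (σ (m - 1, k)) else 0 := by
  simpa using h.star_mon 0 1 m k

lemma Sys.projB (h : Sys σ A B) (m k : ℕ) :
    (1 - B * star B) (bv (σ (m, k))) = if m = 0 then bv (σ (m, k)) else 0 := by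
  rw [sub_apply, ContinuousLinearMap.mul_apply, h.starB]
  by_cases hm : m = 0
  · simp [hm]
  · have : 1 ≤ m := by omega
    simp only [this, if_true, h.hB, hm, if_false, Nat.sub_add_cancel this]
    simp

/-- Generating monomials of the ideal. -/
noncomputable def W (A B : H2 →L[ℂ] H2) (a b i j : ℕ) : H2 →L[ℂ] H2 :=
  A ^ a * B ^ i * (1 - B * star B) * star (A ^ b * B ^ j)

lemma Sys.W_bv (h : Sys σ A B) (a b i j m k : ℕ) :
    W A B a b i j (bv (σ (m, k))) = if m = j ∧ b ≤ k then bv (σ (i, k - b + a)) else 0 := by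
  unfold W
  rw [ContinuousLinearMap.mul_apply, ContinuousLinearMap.mul_apply, h.star_mon]
  by_cases hc : j ≤ m ∧ b ≤ k
  · rw [if_pos hc, h.projB]
    by_cases hm : m - j = 0
    · rw [if_pos hm, h.mon, if_pos (by omega), hm, zero_add]
    · rw [if_neg hm, if_neg (by omega), map_zero]
  · rw [if_neg hc, if_neg (by omega), map_zero, map_zero]

lemma W_star (a b i j : ℕ) : star (W A B a b i j) = W A B b a j i := by
  unfold W
  simp only [star_mul, star_sub, star_one, star_star, mul_assoc]

lemma Sys.W_rank (h : Sys σ A B) (a b i j : ℕ) :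
    W A B a b i j - W A B (a + 1) (b + 1) i j = rankOne2 (σ (i, a)) (σ (j, b)) := by
  apply ext_σ σ
  intro m k
  rw [sub_apply, h.W_bv, h.W_bv, rankOne2_bv]
  simp only [σ.injective.eq_iff, Prod.mk.injEq]
  by_cases hm : m = j
  · subst hm
    rcases lt_trichotomy k b with hk | hk | hk
    · rw [if_neg (by omega), if_neg (by omega), if_neg (by omega), sub_zero]
    · subst hk
      rw [if_pos (by omega), if_neg (by omega), if_pos (by omega), sub_zero]
      simp
    · rw [if_pos (by omega), if_pos (by omega), if_neg (by omega)]
      rw [show k - (b + 1) + (a + 1) = k - b + a by omega, sub_self]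
  · rw [if_neg (by omega), if_neg (by omega), if_neg (by omega), sub_zero]

lemma Sys.A_W (_ : Sys σ A B) (a b i j : ℕ) : A * W A B a b i j = W A B (a + 1) b i j := by
  unfold W; simp only [pow_succ', mul_assoc]

lemma Sys.B_W (h : Sys σ A B) (a b i j : ℕ) : B * W A B a b i j = W A B a b (i + 1) j := by
  apply ext_σ σ
  intro m k
  rw [ContinuousLinearMap.mul_apply, h.W_bv, h.W_bv]
  split_ifs
  · rw [h.hB]
  · simp

lemma Sys.starA_W (h : Sys σ A B) (a b i j : ℕ) :
    star A * W A B a b i j = if a = 0 then W A B 0 (b + 1) i j else W A B (a - 1) b i j := by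
  apply ext_σ σ
  intro m k
  rw [ContinuousLinearMap.mul_apply, h.W_bv]
  by_cases ha : a = 0
  · subst ha
    rw [if_pos rfl, h.W_bv]
    by_cases hc : m = j ∧ b ≤ k
    · rw [if_pos hc, h.starA]
      by_cases hk : 1 ≤ k - b + 0
      · rw [if_pos hk, if_pos (by omega)]; congr 3
      · rw [if_neg hk, if_neg (by omega)]
    · rw [if_neg hc, if_neg (by omega), map_zero]
  · rw [if_neg ha, h.W_bv]
    split_ifs
    · rw [h.starA, if_pos (by omega)]
      congr 3; omega
    · simp

lemma Sys.starB_W (h : Sys σ A B) (a b i j : ℕ) :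
    star B * W A B a b i j = if i = 0 then 0 else W A B a b (i - 1) j := by
  apply ext_σ σ
  intro m k
  rw [ContinuousLinearMap.mul_apply, h.W_bv]
  by_cases hi : i = 0
  · subst hi
    rw [if_pos rfl]
    split_ifs
    · rw [h.starB]; simp
    · simp
  · rw [if_neg hi, h.W_bv]
    split_ifs
    · rw [h.starB, if_pos (by omega)]
    · simp

lemma Sys.Tp_pos (h : Sys σ A B) (a i j : ℕ) : Tp σ (em i j (zf a)) = W A B a 0 i j := by
  apply ext_σ σ
  intro m k
  rw [h.W_bv, Tp_bv]
  by_cases hm : m = j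
  · rw [if_pos (by omega), if_pos (by omega)]
    congr 3
  · rw [if_neg (by omega), if_neg (by omega)]

lemma Sys.Tp_neg (h : Sys σ A B) (b i j : ℕ) : Tp σ (em i j (zf (-b))) = W A B 0 b i j := by
  apply ext_σ σ
  intro m k
  rw [h.W_bv, Tp_bv]
  by_cases hm : m = j ∧ b ≤ k
  · rw [if_pos (by omega), if_pos (by omega)]
    congr 3; omega
  · rw [if_neg (by omega), if_neg (by omega)]

/-- The compacts as a closed submodule. -/
noncomputable def KS : Submodule ℂ (H2 →L[ℂ] H2) :=
  (Submodule.span ℂ {T : H2 →L[ℂ] H2 | ∃ p q : ℕ × ℕ, T = rankOne2 p q}).topologicalClosure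

lemma KS_coe : (KS : Set (H2 →L[ℂ] H2)) = Compacts2 := rfl

lemma rank_mem_KS (p q : ℕ × ℕ) : rankOne2 p q ∈ KS :=
  Submodule.le_topologicalClosure _ (Submodule.subset_span ⟨p, q, rfl⟩)

lemma Sys.W_sub_Tp (h : Sys σ A B) (i j : ℕ) : ∀ a b : ℕ,
    W A B a b i j - Tp σ (em i j (zf ((a : ℤ) - b))) ∈ KS := by
  intro a
  induction a with
  | zero =>
    intro b
    rw [Nat.cast_zero, zero_sub, h.Tp_neg, sub_self]
    exact KS.zero_mem
  | succ a ih =>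
    intro b
    cases b with
    | zero =>
      rw [Nat.cast_zero, sub_zero, h.Tp_pos, sub_self]
      exact KS.zero_mem
    | succ b =>
      have h1 := ih b
      have h2 := h.W_rank a b i j
      have h3 : W A B (a + 1) (b + 1) i j = W A B a b i j - rankOne2 (σ (i, a)) (σ (j, b)) := by
        rw [← h2]; abel
      rw [h3, show (((a + 1 : ℕ) : ℤ) - (b + 1 : ℕ)) = (a : ℤ) - b by push_cast; ring]
      rw [sub_right_comm]
      exact KS.sub_mem h1 (rank_mem_KS _ _)

/-! ### The symbol of the generators -/

lemma Sys.A_J (h : Sys σ A B) (k : ℕ) : A ∘L JL σ k = JL σ (k + 1) := by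
  apply ext_bv; intro m
  rw [ContinuousLinearMap.comp_apply, JL_bv, JL_bv, h.hA]

lemma Sys.starA_J (h : Sys σ A B) (k : ℕ) : star A ∘L JL σ (k + 1) = JL σ k := by
  apply ext_bv; intro m
  rw [ContinuousLinearMap.comp_apply, JL_bv, JL_bv, h.starA]; simp

lemma Sys.starA_J0 (h : Sys σ A B) : star A ∘L JL σ 0 = 0 := by
  apply ext_bv; intro m
  rw [ContinuousLinearMap.comp_apply, JL_bv, h.starA]; simp

lemma starSh (m : ℕ) (j : ℕ) :
    star (Sh ^ j) (bv m) = if j ≤ m then bv (m - j) else 0 := by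
  have h0 : ∀ j m, (Sh ^ j) (bv m) = bv (m + j) := by
    intro j
    induction j with
    | zero => intro m; simp
    | succ i ih =>
      intro m
      rw [pow_succ', ContinuousLinearMap.mul_apply, ih, Sh_bv, add_assoc]
  have hs := star_bv (Sh ^ j) (fun m => m + j) (add_left_injective j) (h0 j) m
  split_ifs with hc
  · apply hs.1
    omega
  · apply hs.2
    intro p hp
    omega

lemma Sh_rank (i j : ℕ) : Sh ^ i * (1 - Sh * star Sh) * star (Sh ^ j) = rankOne1 i j := by
  have h0 : ∀ j m, (Sh ^ j) (bv m) = bv (m + j) := by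
    intro j
    induction j with
    | zero => intro m; simp
    | succ i ih =>
      intro m
      rw [pow_succ', ContinuousLinearMap.mul_apply, ih, Sh_bv, add_assoc]
  have h1 : ∀ m, star Sh (bv m) = if 1 ≤ m then bv (m - 1) else 0 := fun m => by
    simpa using starSh m 1
  have h2 : ∀ m, (1 - Sh * star Sh) (bv m) = if m = 0 then bv m else 0 := by
    intro m
    rw [sub_apply, ContinuousLinearMap.mul_apply, h1]
    by_cases hm : m = 0
    · simp [hm]
    · have : 1 ≤ m := by omega
      simp only [this, if_true, Sh_bv, hm, if_false, Nat.sub_add_cancel this]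
      simp
  apply ext_bv
  intro m
  rw [rankOne1_bv, ContinuousLinearMap.mul_apply, ContinuousLinearMap.mul_apply, starSh]
  by_cases hj : j ≤ m
  · rw [if_pos hj, h2]
    by_cases hm : m - j = 0
    · rw [if_pos hm, h0, if_pos (by omega), hm, zero_add]
    · rw [if_neg hm, if_neg (by omega), map_zero]
  · rw [if_neg hj, if_neg (by omega), map_zero, map_zero]

lemma Sys.B_J (h : Sys σ A B) (k : ℕ) : B ∘L JL σ k = JL σ k ∘L Sh := by
  apply ext_bv; intro m
  rw [ContinuousLinearMap.comp_apply, ContinuousLinearMap.comp_apply, JL_bv, Sh_bv, JL_bv, h.hB]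

lemma Sys.starB_J (h : Sys σ A B) (k : ℕ) : star B ∘L JL σ k = JL σ k ∘L star Sh := by
  apply ext_bv; intro m
  have h1 := starSh m 1
  rw [pow_one] at h1
  rw [ContinuousLinearMap.comp_apply, ContinuousLinearMap.comp_apply, JL_bv, h1, h.starB]
  split_ifs
  · rw [JL_bv]
  · simp

end Stmt16

namespace Stmt16
open scoped ComplexConjugate ENNReal InnerProductSpace Topology
open Filter

set_option synthInstance.maxHeartbeats 400000

variable {σ : ℕ × ℕ ≃ ℕ × ℕ} {A B : H2 →L[ℂ] H2}

/-- The constant shift. -/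
noncomputable def ShC : CB := ContinuousMap.const _ Sh

/-- `z ↦ z • 1`. -/
noncomputable def zC : CB := ⟨fun z => (z : ℂ) • (1 : H1 →L[ℂ] H1), by fun_prop⟩

lemma P_of_exact {x : H2 →L[ℂ] H2} {F : CB} (h : ∀ n z, x ∘L V σ n z = V σ n z ∘L F z) :
    P σ x F := by
  intro ε hε
  refine ⟨0, fun n _ z => ?_⟩
  rw [h, sub_self, norm_zero]; exact hε.le

lemma comp_V (x : H2 →L[ℂ] H2) (n : ℕ) (z : Circle) :
    x ∘L V σ n z = (((Real.sqrt (n + 1))⁻¹ : ℝ) : ℂ) •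
      ∑ k ∈ Finset.range (n + 1), (conj (z : ℂ)) ^ k • (x ∘L JL σ k) := by
  ext1 ξ
  simp [V, smul_apply, sum_apply, map_sum]

lemma V_comp (y : H1 →L[ℂ] H1) (n : ℕ) (z : Circle) :
    V σ n z ∘L y = (((Real.sqrt (n + 1))⁻¹ : ℝ) : ℂ) •
      ∑ k ∈ Finset.range (n + 1), (conj (z : ℂ)) ^ k • (JL σ k ∘L y) := by
  ext1 ξ
  simp [V, smul_apply, sum_apply]

lemma P_of_bound {x : H2 →L[ℂ] H2} {F : CB} (C : ℝ)
    (h : ∀ n z, ‖x ∘L V σ n z - V σ n z ∘L F z‖ ≤ (Real.sqrt (n + 1))⁻¹ * C) : P σ x F := by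
  intro ε hε
  have ht : Tendsto (fun n : ℕ => (Real.sqrt ((n : ℝ) + 1))⁻¹ * C) atTop (𝓝 0) := by
    have h1 : Tendsto (fun n : ℕ => Real.sqrt ((n : ℝ) + 1)) atTop atTop :=
      Real.tendsto_sqrt_atTop.comp
        (tendsto_atTop_add_const_right _ _ tendsto_natCast_atTop_atTop)
    simpa using h1.inv_tendsto_atTop.mul_const C
  obtain ⟨N, hN⟩ := eventually_atTop.mp (ht.eventually_le_const hε)
  exact ⟨N, fun n hn z => (h n z).trans (hN n hn)⟩

lemma Sys.rel_B (h : Sys σ A B) : Rel σ B ShC := by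
  constructor
  · apply P_of_exact
    intro n z
    rw [comp_V, V_comp]
    simp only [h.B_J]
    rfl
  · apply P_of_exact
    intro n z
    rw [comp_V, V_comp]
    simp only [h.starB_J]
    rfl

lemma circle_mul_conj (z : Circle) : (z : ℂ) * conj (z : ℂ) = 1 := by
  rw [Complex.mul_conj]; simp

lemma Sys.rel_A (h : Sys σ A B) : Rel σ A zC := by
  constructor
  · apply P_of_bound 2
    intro n z
    rw [comp_V, V_comp, ← smul_sub, norm_smul, Complex.norm_real,
      Real.norm_of_nonneg (by positivity)]
    gcongr
    have e1 : ∀ k, (conj (z : ℂ)) ^ k • (JL σ k ∘L zC z) =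
        ((conj (z : ℂ)) ^ k * z) • JL σ k := by
      intro k; ext1 ξ; simp [zC, smul_apply, smul_smul]
    simp only [h.A_J, e1]
    rw [Finset.sum_range_succ, Finset.sum_range_succ' (fun k => ((conj (z : ℂ)) ^ k * z) • JL σ k)]
    have e2 : ∀ k, (conj (z : ℂ)) ^ (k + 1) * z = conj (z : ℂ) ^ k := by
      intro k; rw [pow_succ, mul_assoc, mul_comm (conj (z : ℂ)), circle_mul_conj, mul_one]
    simp only [e2]
    rw [add_sub_add_left_eq_sub]
    refine (norm_sub_le _ _).trans ?_
    rw [norm_smul, norm_smul]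
    simp only [norm_mul, norm_pow, RCLike.norm_conj, Circle.norm_coe, one_pow, one_mul]
    linarith [norm_JL σ 0, norm_JL σ (n + 1)]
  · apply P_of_bound 1
    intro n z
    rw [comp_V, V_comp, ← smul_sub, norm_smul, Complex.norm_real,
      Real.norm_of_nonneg (by positivity)]
    gcongr
    have e0 : (star zC) z = conj (z : ℂ) • (1 : H1 →L[ℂ] H1) := by
      change star ((z : ℂ) • (1 : H1 →L[ℂ] H1)) = _
      rw [star_smul, star_one]; rfl
    have e1 : ∀ k, (conj (z : ℂ)) ^ k • (JL σ k ∘L (star zC) z) =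
        ((conj (z : ℂ)) ^ (k + 1)) • JL σ k := by
      intro k; rw [e0]; ext1 ξ; simp [smul_apply, smul_smul, pow_succ]
    simp only [e1]
    rw [Finset.sum_range_succ', Finset.sum_range_succ (fun k => ((conj (z : ℂ)) ^ (k + 1)) • JL σ k)]
    simp only [h.starA_J, h.starA_J0, smul_zero, add_zero]
    rw [sub_add_cancel_left, norm_neg, norm_smul]
    simp only [norm_pow, RCLike.norm_conj, Circle.norm_coe, one_pow, one_mul]
    exact norm_JL σ n

lemma CB_pow_apply (F : CB) (n : ℕ) (z : Circle) : (F ^ n) z = F z ^ n := rfl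
lemma CB_star_apply (F : CB) (z : Circle) : (star F) z = star (F z) := rfl
lemma CB_mul_apply (F G : CB) (z : Circle) : (F * G) z = F z * G z := rfl

lemma symbol_eq (a b i j : ℕ) :
    zC ^ a * ShC ^ i * (1 - ShC * star ShC) * star (zC ^ b * ShC ^ j) =
      em i j (zf ((a : ℤ) - b)) := by
  ext1 z
  have h1 : (1 - ShC * star ShC : CB) z = 1 - Sh * star Sh := rfl
  rw [em_apply, CB_mul_apply, CB_mul_apply, CB_star_apply, CB_mul_apply, CB_mul_apply,
    CB_pow_apply, CB_pow_apply, CB_pow_apply, CB_pow_apply, h1]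
  change ((z : ℂ) • (1 : H1 →L[ℂ] H1)) ^ a * Sh ^ i * (1 - Sh * star Sh) *
    star (((z : ℂ) • (1 : H1 →L[ℂ] H1)) ^ b * Sh ^ j) = _
  have gen : ∀ c d : ℂ, (c • (1 : H1 →L[ℂ] H1)) * Sh ^ i * (1 - Sh * star Sh) *
      star ((d • (1 : H1 →L[ℂ] H1)) * Sh ^ j) = (c * star d) • rankOne1 i j := by
    intro c d
    have e1 : (c • (1 : H1 →L[ℂ] H1)) * Sh ^ i = c • Sh ^ i := by
      rw [smul_mul_assoc, one_mul]
    have e2 : (d • (1 : H1 →L[ℂ] H1)) * Sh ^ j = d • Sh ^ j := by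
      rw [smul_mul_assoc, one_mul]
    rw [e1, e2, star_smul, smul_mul_assoc, smul_mul_assoc, mul_smul_comm, Sh_rank, smul_smul]
  rw [smul_pow, smul_pow, one_pow, one_pow, gen]
  congr 1
  change _ = ((z ^ ((a : ℤ) - b) : Circle) : ℂ)
  rw [zpow_sub, zpow_natCast, zpow_natCast]
  simp
  rw [← Circle.coe_inv_eq_conj, Circle.coe_inv, inv_pow]

lemma Sys.rel_W (h : Sys σ A B) (a b i j : ℕ) :
    Rel σ (W A B a b i j) (em i j (zf ((a : ℤ) - b))) := by
  rw [← symbol_eq]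
  exact (((h.rel_A.pow a).mul (h.rel_B.pow i)).mul (Rel_one.sub (h.rel_B.mul h.rel_B.star))).mul
    ((h.rel_A.pow b).mul (h.rel_B.pow j)).star

lemma Sys.rel_eA (h : Sys σ A B) : Rel σ (1 - A * star A) 0 := by
  have h1 := Rel_one.sub (h.rel_A.mul h.rel_A.star)
  have h2 : (1 - zC * star zC : CB) = 0 := by
    ext1 z
    change 1 - ((z : ℂ) • (1 : H1 →L[ℂ] H1)) * star ((z : ℂ) • (1 : H1 →L[ℂ] H1)) = 0
    rw [star_smul, star_one, smul_mul_smul_comm, one_mul]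
    change 1 - ((z : ℂ) * conj (z : ℂ)) • _ = (0 : H1 →L[ℂ] H1)
    rw [circle_mul_conj, one_smul, sub_self]
  rwa [h2] at h1

lemma rel_closed_exists {s : Set (H2 →L[ℂ] H2)} (hs : ∀ x ∈ s, ∃ F, Rel σ x F)
    {x : H2 →L[ℂ] H2} (hx : x ∈ closure s) : ∃ F, Rel σ x F := by
  obtain ⟨u, hu, hl⟩ := mem_closure_iff_seq_limit.mp hx
  choose G hG using fun k => hs (u k) (hu k)
  obtain ⟨F, _, hF⟩ := Rel.lim hG hl
  exact ⟨F, hF⟩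

lemma T2set_comm (S T : H2 →L[ℂ] H2) : T2set S T = T2set T S := by
  unfold T2set; rw [Set.pair_comm]

lemma Igam_eq (S T : H2 →L[ℂ] H2) : Igam S T = Idel T S := by
  unfold Igam Idel; rw [T2set_comm]

lemma Sys.rel_T2 (h : Sys σ A B) {x : H2 →L[ℂ] H2} (hx : x ∈ T2set A B) : ∃ F, Rel σ x F := by
  refine rel_closed_exists ?_ hx
  intro x hx
  refine StarAlgebra.adjoin_induction (p := fun x _ => ∃ F, Rel σ x F) ?_ ?_ ?_ ?_ ?_ hx
  · rintro x (rfl | rfl)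
    · exact ⟨_, h.rel_A⟩
    · exact ⟨_, h.rel_B⟩
  · intro r
    rw [Algebra.algebraMap_eq_smul_one]
    exact ⟨_, Rel_one.smul r⟩
  · rintro x y _ _ ⟨F, hF⟩ ⟨G, hG⟩
    exact ⟨_, hF.add hG⟩
  · rintro x y _ _ ⟨F, hF⟩ ⟨G, hG⟩
    exact ⟨_, hF.mul hG⟩
  · rintro x _ ⟨F, hF⟩
    exact ⟨_, hF.star⟩

/-- The ideal as a closed submodule. -/
noncomputable def IS (S T : H2 →L[ℂ] H2) : Submodule ℂ (H2 →L[ℂ] H2) :=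
  (Submodule.span ℂ {w : H2 →L[ℂ] H2 | ∃ x ∈ T2set S T, ∃ y ∈ T2set S T,
    w = x * (1 - S * star S) * y}).topologicalClosure

lemma IS_coe (S T : H2 →L[ℂ] H2) : (IS S T : Set (H2 →L[ℂ] H2)) = Idel S T := rfl

lemma mem_IS {S T x : H2 →L[ℂ] H2} : x ∈ IS S T ↔ x ∈ Idel S T := Iff.rfl

/-- `1 - A A*` generates operators with zero symbol. -/
lemma Sys.rel_zero (h : Sys σ A B) {x : H2 →L[ℂ] H2} (hx : x ∈ Idel A B) : Rel σ x 0 := by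
  have key : ∀ x ∈ Submodule.span ℂ {w : H2 →L[ℂ] H2 | ∃ x ∈ T2set A B, ∃ y ∈ T2set A B,
      w = x * (1 - A * star A) * y}, Rel σ x 0 := by
    intro x hx
    induction hx using Submodule.span_induction with
    | mem x hx =>
      obtain ⟨a, ha, b, hb, rfl⟩ := hx
      obtain ⟨F, hF⟩ := h.rel_T2 ha
      obtain ⟨G, hG⟩ := h.rel_T2 hb
      have := (hF.mul h.rel_eA).mul hG
      have e : F * 0 * G = (0 : CB) := by
        ext1 z
        change F z * 0 * G z = 0
        rw [mul_zero, zero_mul]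
      rwa [e] at this
    | zero => exact Rel_zero
    | add x y _ _ hx hy => have := hx.add hy; rwa [add_zero] at this
    | smul c x _ hx =>
      have := hx.smul c
      have e : c • (0 : CB) = 0 := by
        ext1 z
        exact smul_zero c
      rwa [e] at this
  obtain ⟨u, hu, hl⟩ := mem_closure_iff_seq_limit.mp hx
  obtain ⟨F, h1, hF⟩ := Rel.lim (fun k => key (u k) (hu k)) hl
  have : F = 0 := tendsto_nhds_unique h1 tendsto_const_nhds
  rwa [this] at hF

end Stmt16

namespace Stmt16
open scoped ComplexConjugate ENNReal InnerProductSpace Topology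
open Filter

set_option synthInstance.maxHeartbeats 400000

variable {σ : ℕ × ℕ ≃ ℕ × ℕ} {A B : H2 →L[ℂ] H2}

/-- Closed span of the monomials. -/
noncomputable def WS (A B : H2 →L[ℂ] H2) : Submodule ℂ (H2 →L[ℂ] H2) :=
  (Submodule.span ℂ {w | ∃ a b i j : ℕ, w = W A B a b i j}).topologicalClosure

lemma WS_closed : IsClosed (WS A B : Set (H2 →L[ℂ] H2)) :=
  Submodule.isClosed_topologicalClosure _

lemma W_mem_WS (a b i j : ℕ) : W A B a b i j ∈ WS A B :=
  Submodule.le_topologicalClosure _ (Submodule.subset_span ⟨a, b, i, j, rfl⟩)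

lemma WS_le {M : Submodule ℂ (H2 →L[ℂ] H2)} (hM : IsClosed (M : Set (H2 →L[ℂ] H2)))
    (h : ∀ a b i j, W A B a b i j ∈ M) : WS A B ≤ M := by
  refine Submodule.topologicalClosure_minimal _ ?_ hM
  rw [Submodule.span_le]
  rintro _ ⟨a, b, i, j, rfl⟩
  exact h a b i j

lemma WS_mul_of (x : H2 →L[ℂ] H2) (h : ∀ a b i j, x * W A B a b i j ∈ WS A B) :
    ∀ w ∈ WS A B, x * w ∈ WS A B := by
  have hc : IsClosed (((WS A B).comap (LinearMap.mulLeft ℂ x) :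
      Submodule ℂ (H2 →L[ℂ] H2)) : Set (H2 →L[ℂ] H2)) :=
    WS_closed.preimage (continuous_const.mul continuous_id)
  intro w hw
  exact WS_le hc h hw

lemma WS_star : ∀ w ∈ WS A B, star w ∈ WS A B := by
  intro w hw
  have key : ∀ w ∈ Submodule.span ℂ {w | ∃ a b i j : ℕ, w = W A B a b i j},
      star w ∈ WS A B := by
    intro w hw
    induction hw using Submodule.span_induction with
    | mem x hx =>
      obtain ⟨a, b, i, j, rfl⟩ := hx
      rw [W_star]; exact W_mem_WS _ _ _ _
    | zero => rw [star_zero]; exact (WS A B).zero_mem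
    | add x y _ _ hx hy => rw [star_add]; exact (WS A B).add_mem hx hy
    | smul c x _ hx => rw [star_smul]; exact (WS A B).smul_mem _ hx
  have h2 := map_mem_closure continuous_star hw key
  exact (WS_closed.closure_subset : _) h2

lemma Sys.WS_left (h : Sys σ A B) {x : H2 →L[ℂ] H2} (hx : x ∈ T2set A B) :
    ∀ w ∈ WS A B, x * w ∈ WS A B := by
  have key : ∀ x ∈ StarAlgebra.adjoin ℂ {A, B}, (∀ w ∈ WS A B, x * w ∈ WS A B) ∧
      (∀ w ∈ WS A B, star x * w ∈ WS A B) := by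
    intro x hx
    refine StarAlgebra.adjoin_induction (p := fun x _ => (∀ w ∈ WS A B, x * w ∈ WS A B) ∧
      (∀ w ∈ WS A B, star x * w ∈ WS A B)) ?_ ?_ ?_ ?_ ?_ hx
    · rintro x (rfl | rfl)
      · refine ⟨WS_mul_of _ fun a b i j => ?_, WS_mul_of _ fun a b i j => ?_⟩
        · rw [h.A_W]; exact W_mem_WS _ _ _ _
        · rw [h.starA_W]; split_ifs <;> exact W_mem_WS _ _ _ _
      · refine ⟨WS_mul_of _ fun a b i j => ?_, WS_mul_of _ fun a b i j => ?_⟩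
        · rw [h.B_W]; exact W_mem_WS _ _ _ _
        · rw [h.starB_W]; split_ifs
          · exact (WS A _).zero_mem
          · exact W_mem_WS _ _ _ _
    · intro r
      rw [Algebra.algebraMap_eq_smul_one, star_smul, star_one]
      constructor
      · intro w hw; rw [smul_mul_assoc, one_mul]; exact (WS A B).smul_mem _ hw
      · intro w hw; rw [smul_mul_assoc, one_mul]; exact (WS A B).smul_mem _ hw
    · rintro x y _ _ ⟨h1, h2⟩ ⟨h3, h4⟩
      constructor
      · intro w hw; rw [add_mul]; exact (WS A B).add_mem (h1 w hw) (h3 w hw)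
      · intro w hw; rw [star_add, add_mul]; exact (WS A B).add_mem (h2 w hw) (h4 w hw)
    · rintro x y _ _ ⟨h1, h2⟩ ⟨h3, h4⟩
      constructor
      · intro w hw; rw [mul_assoc]; exact h1 _ (h3 w hw)
      · intro w hw; rw [star_mul, mul_assoc]; exact h4 _ (h2 w hw)
    · rintro x _ ⟨h1, h2⟩
      refine ⟨h2, ?_⟩
      rw [star_star]; exact h1
  intro w hw
  have hc : Continuous (fun x : H2 →L[ℂ] H2 => x * w) := continuous_id.mul continuous_const
  have h2 : (fun x : H2 →L[ℂ] H2 => x * w) x ∈ closure (WS A B : Set (H2 →L[ℂ] H2)) :=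
    map_mem_closure (f := fun x : H2 →L[ℂ] H2 => x * w) hc hx fun x hx => (key x hx).1 w hw
  exact WS_closed.closure_subset h2

lemma T2set_star {x : H2 →L[ℂ] H2} (hx : x ∈ T2set A B) : star x ∈ T2set A B :=
  map_mem_closure continuous_star hx fun _ hy => star_mem hy

lemma Sys.Idel_le (h : Sys σ A B) : IS B A ≤ WS A B := by
  refine Submodule.topologicalClosure_minimal _ ?_ WS_closed
  rw [Submodule.span_le]
  rintro _ ⟨x, hx, y, hy, rfl⟩
  rw [T2set_comm] at hx hy
  have h0 : 1 - B * star B ∈ WS A B := by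
    have := W_mem_WS (A := A) (B := B) 0 0 0 0
    simpa [W] using this
  have h1 := h.WS_left (T2set_star hy) _ (WS_star _ (h.WS_left hx _ h0))
  have h2 := WS_star _ h1
  rw [star_mul, star_star, star_star] at h2
  exact h2

lemma W_mem_IS (a b i j : ℕ) : W A B a b i j ∈ IS B A := by
  refine Submodule.le_topologicalClosure _ (Submodule.subset_span ?_)
  have hm : ∀ a i, A ^ a * B ^ i ∈ StarAlgebra.adjoin ℂ {B, A} := fun a i =>
    mul_mem (pow_mem (StarAlgebra.subset_adjoin ℂ _ (by simp)) a)
      (pow_mem (StarAlgebra.subset_adjoin ℂ _ (by simp)) i)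
  exact ⟨_, subset_closure (hm a i), _, subset_closure (star_mem (hm b j)), rfl⟩

lemma IS_closed (S T : H2 →L[ℂ] H2) : IsClosed (IS S T : Set (H2 →L[ℂ] H2)) :=
  Submodule.isClosed_topologicalClosure _

lemma KS_closed : IsClosed (KS : Set (H2 →L[ℂ] H2)) :=
  Submodule.isClosed_topologicalClosure _

lemma Sys.KS_le (h : Sys σ A B) : KS ≤ IS B A := by
  refine Submodule.topologicalClosure_minimal _ ?_ (IS_closed _ _)
  rw [Submodule.span_le]
  rintro _ ⟨p, q, rfl⟩
  have := h.W_rank (σ.symm p).2 (σ.symm q).2 (σ.symm p).1 (σ.symm q).1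
  simp only [Prod.mk.eta, Equiv.apply_symm_apply] at this
  rw [← this]
  exact (IS B A).sub_mem (W_mem_IS _ _ _ _) (W_mem_IS _ _ _ _)

lemma Sys.Tp_em (h : Sys σ A B) (i j : ℕ) (n : ℤ) :
    ∃ a b : ℕ, n = (a : ℤ) - b ∧ Tp σ (em i j (zf n)) = W A B a b i j := by
  obtain ⟨m, rfl | rfl⟩ := n.eq_nat_or_neg
  · exact ⟨m, 0, by simp, h.Tp_pos m i j⟩
  · exact ⟨0, m, by simp, h.Tp_neg m i j⟩

lemma Sys.Tp_mem (h : Sys σ A B) {F : CB} (hF : F ∈ KC) : Tp σ F ∈ IS B A := by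
  refine KC_sub ((IS B A).comap (Tp σ).toLinearMap) ?_ ?_ hF
  · exact (IS_closed B A).preimage (Tp σ).continuous
  · intro i j n
    obtain ⟨a, b, _, e⟩ := h.Tp_em i j n
    change Tp σ (em i j (zf n)) ∈ IS B A
    rw [e]; exact W_mem_IS _ _ _ _

lemma Sys.Tp_rel (h : Sys σ A B) {F : CB} (hF : F ∈ KC) : Rel σ (Tp σ F) F := by
  let M : Submodule ℂ C(Circle, H1 →L[ℂ] H1) :=
    { carrier := {F | Rel σ (Tp σ F) F}
      add_mem' := fun {F G} (hF : Rel σ (Tp σ F) F) (hG : Rel σ (Tp σ G) G) => by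
        change Rel σ (Tp σ (F + G)) (F + G)
        rw [map_add]; exact hF.add hG
      zero_mem' := by
        change Rel σ (Tp σ 0) 0
        rw [map_zero]; exact Rel_zero
      smul_mem' := fun c F (hF : Rel σ (Tp σ F) F) => by
        change Rel σ (Tp σ (c • F)) (c • F)
        rw [map_smul]; exact hF.smul c }
  refine KC_sub M ?_ ?_ hF
  · refine IsSeqClosed.isClosed ?_
    intro u G hu hl
    obtain ⟨G', h1, h2⟩ := Rel.lim hu (((Tp σ).continuous.tendsto G).comp hl)
    have : G' = G := tendsto_nhds_unique h1 hl
    rw [this] at h2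
    exact h2
  · intro i j n
    obtain ⟨a, b, rfl, e⟩ := h.Tp_em i j n
    change Rel σ (Tp σ (em i j (zf _))) _
    rw [e]; exact h.rel_W a b i j

/-- `KC` as a closed submodule. -/
noncomputable def KCS : Submodule ℂ CB :=
  (Submodule.span ℂ {F : C(Circle, H1 →L[ℂ] H1) |
    ∃ (f : C(Circle, ℂ)) (p q : ℕ), ∀ z, F z = f z • rankOne1 p q}).topologicalClosure

lemma mem_KCS {F : CB} : F ∈ KCS ↔ F ∈ KC := Iff.rfl

lemma KC_closed : IsClosed KC := isClosed_closure

lemma Sys.main (h : Sys σ A B) {x : H2 →L[ℂ] H2} (hx : x ∈ Idel B A) :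
    ∃ F ∈ KC, Rel σ x F ∧ x - Tp σ F ∈ KS := by
  have hx1 : x ∈ WS A B := h.Idel_le hx
  have key : ∀ x ∈ Submodule.span ℂ {w | ∃ a b i j : ℕ, w = W A B a b i j},
      ∃ F ∈ KC, Rel σ x F ∧ x - Tp σ F ∈ KS := by
    intro w hw
    induction hw using Submodule.span_induction with
    | mem x hx =>
      obtain ⟨a, b, i, j, rfl⟩ := hx
      exact ⟨_, em_mem_KC _ _ _, h.rel_W a b i j, h.W_sub_Tp i j a b⟩
    | zero =>
      refine ⟨0, KCS.zero_mem, Rel_zero, ?_⟩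
      rw [map_zero, sub_zero]; exact KS.zero_mem
    | add x y _ _ hx hy =>
      obtain ⟨F, hF, h1, h2⟩ := hx
      obtain ⟨G, hG, h3, h4⟩ := hy
      refine ⟨F + G, KCS.add_mem hF hG, h1.add h3, ?_⟩
      rw [map_add, add_sub_add_comm]; exact KS.add_mem h2 h4
    | smul c x _ hx =>
      obtain ⟨F, hF, h1, h2⟩ := hx
      refine ⟨c • F, KCS.smul_mem c hF, h1.smul c, ?_⟩
      rw [map_smul, ← smul_sub]; exact KS.smul_mem c h2
  obtain ⟨u, hu, hl⟩ := mem_closure_iff_seq_limit.mp hx1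
  choose G hG1 hG2 hG3 using fun k => key (u k) (hu k)
  obtain ⟨F, h1, h2⟩ := Rel.lim hG2 hl
  refine ⟨F, KC_closed.mem_of_tendsto h1 (Eventually.of_forall hG1), h2, ?_⟩
  have h3 := hl.sub (((Tp σ).continuous.tendsto F).comp h1)
  exact KS_closed.mem_of_tendsto h3 (Eventually.of_forall hG3)

section final
variable {τ : ℕ × ℕ ≃ ℕ × ℕ}

/-- `x` has both symbols, and is determined by them modulo compacts. -/
lemma joint (h : Sys σ A B) (k : Sys τ B A) {x : H2 →L[ℂ] H2}
    (hx : x ∈ closure {w : H2 →L[ℂ] H2 | ∃ y ∈ Idel B A, ∃ z ∈ Idel A B, w = y + z}) :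
    ∃ F ∈ KC, ∃ G ∈ KC, Rel σ x F ∧ Rel τ x G ∧ x - (Tp σ F + Tp τ G) ∈ KS := by
  have key : ∀ x ∈ {w : H2 →L[ℂ] H2 | ∃ y ∈ Idel B A, ∃ z ∈ Idel A B, w = y + z},
      ∃ F ∈ KC, ∃ G ∈ KC, Rel σ x F ∧ Rel τ x G ∧ x - (Tp σ F + Tp τ G) ∈ KS := by
    rintro _ ⟨y, hy, z, hz, rfl⟩
    obtain ⟨F, hF, h1, h2⟩ := h.main hy
    obtain ⟨G, hG, h3, h4⟩ := k.main hz
    have h5 := h1.add (h.rel_zero hz)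
    have h6 := (k.rel_zero hy).add h3
    rw [add_zero] at h5
    rw [zero_add] at h6
    refine ⟨F, hF, G, hG, h5, h6, ?_⟩
    rw [add_sub_add_comm]; exact KS.add_mem h2 h4
  obtain ⟨u, hu, hl⟩ := mem_closure_iff_seq_limit.mp hx
  choose F hF G hG h1 h2 h3 using fun k => key (u k) (hu k)
  obtain ⟨F', e1, e2⟩ := Rel.lim h1 hl
  obtain ⟨G', e3, e4⟩ := Rel.lim h2 hl
  refine ⟨F', KC_closed.mem_of_tendsto e1 (Eventually.of_forall hF),
    G', KC_closed.mem_of_tendsto e3 (Eventually.of_forall hG), e2, e4, ?_⟩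
  have h4 := hl.sub ((((Tp σ).continuous.tendsto F').comp e1).add
    (((Tp τ).continuous.tendsto G').comp e3))
  exact KS_closed.mem_of_tendsto h4 (Eventually.of_forall h3)

open Classical in
/-- The symbol of `x`, zero if there is none. -/
noncomputable def sym (σ : ℕ × ℕ ≃ ℕ × ℕ) (x : H2 →L[ℂ] H2) : CB :=
  if h : ∃ F, Rel σ x F then h.choose else 0

lemma sym_eq {x : H2 →L[ℂ] H2} {F : CB} (h : Rel σ x F) : sym σ x = F := by
  have h1 : ∃ F, Rel σ x F := ⟨F, h⟩
  unfold sym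
  rw [dif_pos h1]
  exact h1.choose_spec.unique h

theorem final (h : Sys σ A B) (k : Sys τ B A) :
    Idel B A ∩ Idel A B = Compacts2 ∧
    ∃ ρ : (H2 →L[ℂ] H2) → CB × CB,
      (∀ x ∈ closure {w : H2 →L[ℂ] H2 | ∃ y ∈ Idel B A, ∃ z ∈ Idel A B, w = y + z},
        ∀ y ∈ closure {w : H2 →L[ℂ] H2 | ∃ y' ∈ Idel B A, ∃ z ∈ Idel A B, w = y' + z},
          ρ (x + y) = ρ x + ρ y ∧ ρ (x * y) = ρ x * ρ y) ∧
      (∀ (c : ℂ), ∀ x ∈ closure {w : H2 →L[ℂ] H2 | ∃ y ∈ Idel B A, ∃ z ∈ Idel A B, w = y + z},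
        ρ (c • x) = c • ρ x) ∧
      (∀ x ∈ closure {w : H2 →L[ℂ] H2 | ∃ y ∈ Idel B A, ∃ z ∈ Idel A B, w = y + z},
        ρ (star x) = star (ρ x)) ∧
      ρ '' closure {w : H2 →L[ℂ] H2 | ∃ y ∈ Idel B A, ∃ z ∈ Idel A B, w = y + z} =
        KC ×ˢ KC ∧
      (∀ x ∈ closure {w : H2 →L[ℂ] H2 | ∃ y ∈ Idel B A, ∃ z ∈ Idel A B, w = y + z},
        (ρ x = 0 ↔ x ∈ Idel B A ∩ Idel A B)) := by
  have hK : Compacts2 ⊆ Idel B A ∩ Idel A B := fun x hx => ⟨h.KS_le hx, k.KS_le hx⟩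
  have hz : ∀ x ∈ closure {w : H2 →L[ℂ] H2 | ∃ y ∈ Idel B A, ∃ z ∈ Idel A B, w = y + z},
      Rel σ x 0 → Rel τ x 0 → x ∈ Compacts2 := by
    intro x hx h1 h2
    obtain ⟨F, _, G, _, h3, h4, h5⟩ := joint h k hx
    rw [h3.unique h1, h4.unique h2, map_zero, map_zero, add_zero, sub_zero] at h5
    exact h5
  have hI : Idel B A ∩ Idel A B = Compacts2 := by
    refine Set.Subset.antisymm ?_ hK
    rintro x ⟨h1, h2⟩
    refine hz x (subset_closure ⟨x, h1, 0, (IS A B).zero_mem, (add_zero x).symm⟩)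
      (h.rel_zero h2) (k.rel_zero h1)
  refine ⟨hI, fun x => (sym σ x, sym τ x), ?_, ?_, ?_, ?_, ?_⟩
  · intro x hx y hy
    obtain ⟨F, _, G, _, h1, h2, _⟩ := joint h k hx
    obtain ⟨F', _, G', _, h3, h4, _⟩ := joint h k hy
    dsimp only
    rw [sym_eq h1, sym_eq h2, sym_eq h3, sym_eq h4, sym_eq (h1.add h3), sym_eq (h2.add h4),
      sym_eq (h1.mul h3), sym_eq (h2.mul h4)]
    exact ⟨rfl, rfl⟩
  · intro c x hx
    obtain ⟨F, _, G, _, h1, h2, _⟩ := joint h k hx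
    dsimp only
    rw [sym_eq h1, sym_eq h2, sym_eq (h1.smul c), sym_eq (h2.smul c)]
    rfl
  · intro x hx
    obtain ⟨F, _, G, _, h1, h2, _⟩ := joint h k hx
    dsimp only
    rw [sym_eq h1, sym_eq h2, sym_eq h1.star, sym_eq h2.star]
    rfl
  · ext ⟨F, G⟩
    constructor
    · rintro ⟨x, hx, e⟩
      obtain ⟨F', h1, G', h2, h3, h4, _⟩ := joint h k hx
      dsimp only at e
      rw [sym_eq h3, sym_eq h4] at e
      rw [← e]
      exact ⟨h1, h2⟩
    · rintro ⟨hF, hG⟩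
      have m1 : Tp σ F ∈ Idel B A := h.Tp_mem hF
      have m2 : Tp τ G ∈ Idel A B := k.Tp_mem hG
      have r1 := (h.Tp_rel hF).add (h.rel_zero m2)
      have r2 := (k.rel_zero m1).add (k.Tp_rel hG)
      rw [add_zero] at r1
      rw [zero_add] at r2
      refine ⟨Tp σ F + Tp τ G, subset_closure ⟨_, m1, _, m2, rfl⟩, ?_⟩
      dsimp only
      rw [sym_eq r1, sym_eq r2]
  · intro x hx
    obtain ⟨F, _, G, _, h1, h2, _⟩ := joint h k hx
    dsimp only
    rw [sym_eq h1, sym_eq h2]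
    constructor
    · intro e
      have eF : F = 0 := congrArg Prod.fst e
      have eG : G = 0 := congrArg Prod.snd e
      rw [eF] at h1
      rw [eG] at h2
      exact hK (hz x hx h1 h2)
    · rintro ⟨m1, m2⟩
      rw [h1.unique (h.rel_zero m2), h2.unique (k.rel_zero m1)]
      rfl

end final

end Stmt16

/-- `I_δ ∩ I_γ = K(ℓ²(ℕ²))`, and the quotient
`(I_δ + I_γ)/(I_δ ∩ I_γ)` is `*`-isomorphic to
`[K(ℓ²(ℕ)) ⊗ C(𝕋)] ⊕ [K(ℓ²(ℕ)) ⊗ C(𝕋)]`, expressed via a `*`-linear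
multiplicative surjection of `I_δ + I_γ` onto the direct sum whose kernel is
exactly `I_δ ∩ I_γ`. -/
theorem stmt16 (S₁ S₂ : H2 →L[ℂ] H2)
    (hS₁ : ∀ p : ℕ × ℕ, S₁ (lp.single 2 p (1 : ℂ)) = lp.single 2 (p.1 + 1, p.2) (1 : ℂ))
    (hS₂ : ∀ p : ℕ × ℕ, S₂ (lp.single 2 p (1 : ℂ)) = lp.single 2 (p.1, p.2 + 1) (1 : ℂ)) :
    Idel S₁ S₂ ∩ Igam S₁ S₂ = Compacts2 ∧
    ∃ ρ : (H2 →L[ℂ] H2) → C(Circle, H1 →L[ℂ] H1) × C(Circle, H1 →L[ℂ] H1),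
      (∀ x ∈ closure {w : H2 →L[ℂ] H2 | ∃ y ∈ Idel S₁ S₂, ∃ z ∈ Igam S₁ S₂, w = y + z},
        ∀ y ∈ closure {w : H2 →L[ℂ] H2 | ∃ y' ∈ Idel S₁ S₂, ∃ z ∈ Igam S₁ S₂, w = y' + z},
          ρ (x + y) = ρ x + ρ y ∧ ρ (x * y) = ρ x * ρ y) ∧
      (∀ (c : ℂ), ∀ x ∈ closure {w : H2 →L[ℂ] H2 | ∃ y ∈ Idel S₁ S₂, ∃ z ∈ Igam S₁ S₂, w = y + z},
        ρ (c • x) = c • ρ x) ∧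
      (∀ x ∈ closure {w : H2 →L[ℂ] H2 | ∃ y ∈ Idel S₁ S₂, ∃ z ∈ Igam S₁ S₂, w = y + z},
        ρ (star x) = star (ρ x)) ∧
      ρ '' closure {w : H2 →L[ℂ] H2 | ∃ y ∈ Idel S₁ S₂, ∃ z ∈ Igam S₁ S₂, w = y + z} =
        KC ×ˢ KC ∧
      (∀ x ∈ closure {w : H2 →L[ℂ] H2 | ∃ y ∈ Idel S₁ S₂, ∃ z ∈ Igam S₁ S₂, w = y + z},
        (ρ x = 0 ↔ x ∈ Idel S₁ S₂ ∩ Igam S₁ S₂)) := by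
  have h : Stmt16.Sys (Equiv.refl (ℕ × ℕ)) S₂ S₁ :=
    ⟨fun m k => hS₂ (m, k), fun m k => hS₁ (m, k)⟩
  have k : Stmt16.Sys (Equiv.prodComm ℕ ℕ) S₁ S₂ :=
    ⟨fun m k => hS₁ (k, m), fun m k => hS₂ (k, m)⟩
  rw [Stmt16.Igam_eq]
  exact Stmt16.final h k
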